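/- Let A = kQ/I be a non simply connected toupie algebra with dim_k e_0 A e_∞ = 1 whose unique branch in the ideal I is w_1, and let M be an indecomposable A-module with M_0 ≠ 0 and M_∞ ≠ 0 (as a representation of (Q,I)). Then the top of M has at most two simple summands, namely copies of S_0 and possibly S_y, and the socle of M has at most two simple summands, namely copies of S_∞ and possibly S_x, where x and y are vertices lying on the branch w_1; in fact M is isomorphic to the module D_{xy} determined by x and y. -/

import Mathlib

/-!
Formalization preamble for "Toupie algebras".

We realize the bound quiver algebra `A = kQ/I` of a toupie quiver `Q` concretely:
the path algebra `kQ` is realized, via its (faithful) left regular representation,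
as the subalgebra of `Module.End k (paths → k)` generated by the operators of left
multiplication by the trivial paths `e_v` and by the arrows of `Q`.  Paths are
composed from left to right (`p * q` = "first `p`, then `q`"), as in
Assem–Simson–Skowroński, so that paths from the source `0` to the sink `∞` span
`e₀ (kQ) e∞`, and (right) `A`-modules are identified with representations of `(Q, I)`.
Right `A`-modules are formalized as (left) modules over `Aᵐᵒᵖ`.
-/

set_option synthInstance.maxHeartbeats 400000
set_option maxHeartbeats 800000

noncomputable section
open scoped Classical
open MulOpposite

universe u

namespace Toupie

/-- Vertices of a toupie quiver with `t` branches, branch `i` having length `ℓ i ≥ 1`: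
the unique source `src`, the unique sink `snk`, and for each branch `i` its interior
vertices `mid i a` (the `(a+1)`-st vertex on branch `i`, for `a : Fin (ℓ i - 1)`). -/
inductive Vtx (t : ℕ) (ℓ : Fin t → ℕ) : Type
  | src : Vtx t ℓ
  | snk : Vtx t ℓ
  | mid (i : Fin t) (a : Fin (ℓ i - 1)) : Vtx t ℓ

/-- The `a`-th vertex on branch `i`, for `0 ≤ a ≤ ℓ i`
(`a = 0` is the source, `a = ℓ i` is the sink). -/
def vtx (t : ℕ) (ℓ : Fin t → ℕ) (i : Fin t) (a : ℕ) : Vtx t ℓ :=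
  if a = 0 then .src else if h : a - 1 < ℓ i - 1 then .mid i ⟨a - 1, h⟩ else .snk

/-- The paths of a toupie quiver: trivial paths at the vertices, and for each branch
`i` and `a < b ≤ ℓ i` the path `sub i a b` along branch `i` from its `a`-th vertex to
its `b`-th vertex.  (`sub i 0 (ℓ i)` is the `i`-th branch `w i`.) -/
inductive PIdx (t : ℕ) (ℓ : Fin t → ℕ) : Type
  | vert (v : Vtx t ℓ) : PIdx t ℓ
  | sub (i : Fin t) (a b : ℕ) (hab : a < b) (hb : b ≤ ℓ i) : PIdx t ℓ

variable (k : Type u) [Field k] (t : ℕ) (ℓ : Fin t → ℕ)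

/-- The vector space with basis the set of paths of the toupie quiver. -/
abbrev PSp : Type u := PIdx t ℓ → k

variable {t ℓ}

/-- The starting vertex of a path. -/
def startIdx : PIdx t ℓ → Vtx t ℓ
  | .vert v => v
  | .sub i a _ _ _ => vtx t ℓ i a

/-- Left multiplication by the trivial path (primitive idempotent) `e_v`. -/
def Ev (v : Vtx t ℓ) : Module.End k (PSp k t ℓ) where
  toFun f := fun p => if startIdx p = v then f p else 0
  map_add' f g := by funext p; by_cases h : startIdx p = v <;> simp [h]
  map_smul' c f := by funext p; by_cases h : startIdx p = v <;> simp [h]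

/-- Strip the `j`-th arrow of branch `i` (the arrow `vtx i j ⟶ vtx i (j+1)`) from the
front of a path, if possible. -/
def strip (i : Fin t) (j : ℕ) : PIdx t ℓ → Option (PIdx t ℓ)
  | .vert _ => none
  | .sub i' a b _ hb =>
      if h : i' = i ∧ a = j then
        if hb2 : j + 1 < b then some (.sub i (j + 1) b hb2 (h.1 ▸ hb))
        else some (.vert (vtx t ℓ i b))
      else none

/-- Left multiplication by the `j`-th arrow of branch `i`
(the arrow from `vtx i j` to `vtx i (j+1)`, for `j < ℓ i`; the zero operator for junk `j`). -/
def Ar (i : Fin t) (j : ℕ) : Module.End k (PSp k t ℓ) where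
  toFun f := fun p => (strip i j p).elim 0 f
  map_add' f g := by funext p; rcases h : strip i j p with _ | q <;> simp [h]
  map_smul' c f := by funext p; rcases h : strip i j p with _ | q <;> simp [h]

variable (t ℓ)

/-- The generators of the path algebra: the trivial paths and the arrows. -/
def gens : Set (Module.End k (PSp k t ℓ)) :=
  Set.range (Ev k) ∪ {x | ∃ i j, x = Ar k i j}

/-- The path algebra `kQ` of the toupie quiver, realized as the subalgebra of
`Module.End k (PSp k t ℓ)` generated by left multiplication by trivial paths and arrows. -/
def PathAlg : Subalgebra k (Module.End k (PSp k t ℓ)) :=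
  Algebra.adjoin k (gens k t ℓ)

variable {k t ℓ}

/-- The trivial path `e_v` as an element of the path algebra. -/
def eV (v : Vtx t ℓ) : PathAlg k t ℓ :=
  ⟨Ev k v, Algebra.subset_adjoin (Or.inl ⟨v, rfl⟩)⟩

/-- The `j`-th arrow of branch `i` as an element of the path algebra. -/
def arE (i : Fin t) (j : ℕ) : PathAlg k t ℓ :=
  ⟨Ar k i j, Algebra.subset_adjoin (Or.inr ⟨i, j, rfl⟩)⟩

/-- The path along branch `i` from its `a`-th vertex to its `b`-th vertex, as an element
of the path algebra: the product (composed from left to right) of the arrows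
`a → a+1 → ⋯ → b`.  (For `b ≤ a` this is the empty product `1`.) -/
def subE (i : Fin t) (a b : ℕ) : PathAlg k t ℓ :=
  (((List.range (b - a)).map fun s => arE i (a + s)).prod)

/-- The `i`-th branch `w i` (the path from the source to the sink along branch `i`)
as an element of the path algebra. -/
def wE (i : Fin t) : PathAlg k t ℓ := subE i 0 (ℓ i)

variable {k : Type u} [Field k]

/-- A toupie algebra `A = kQ/I`: a toupie quiver `Q` (a non-linear quiver with a unique
source, a unique sink, and all other vertices having exactly one incoming and one
outgoing arrow, i.e. `t ≥ 2` branches of lengths `ℓ i ≥ 1`), together with an admissible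
ideal `I` of the path algebra `kQ`.  Since `Q` is finite and acyclic, the arrow ideal is
nilpotent, so admissibility amounts to `I ⊆ R_Q²`, i.e. every element of `I` is a linear
combination of paths of length `≥ 2`. -/
structure ToupieAlg (k : Type u) [Field k] : Type u where
  t : ℕ
  ht : 2 ≤ t
  ℓ : Fin t → ℕ
  hℓ : ∀ i, 1 ≤ ℓ i
  I : TwoSidedIdeal (PathAlg k t ℓ)
  adm : ∀ x ∈ I, x ∈ Submodule.span k
    {y : PathAlg k t ℓ | ∃ i a b, a + 2 ≤ b ∧ b ≤ ℓ i ∧ y = subE i a b}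

variable (T : ToupieAlg k)

/-- The underlying algebra `A = kQ/I` of a toupie algebra. -/
def Alg : Type u := T.I.ringCon.Quotient

instance : Ring (Alg T) := inferInstanceAs (Ring T.I.ringCon.Quotient)

/-- The quotient map `kQ → A = kQ/I`. -/
def mkA : PathAlg k T.t T.ℓ →+* Alg T := T.I.ringCon.mk'

lemma mkA_surjective : Function.Surjective (mkA T) := Quotient.mk''_surjective

instance : Algebra k (Alg T) :=
  RingHom.toAlgebra' ((mkA T).comp (algebraMap k (PathAlg k T.t T.ℓ)))
    (by
      intro c x
      obtain ⟨y, rfl⟩ := mkA_surjective T x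
      simp only [RingHom.coe_comp, Function.comp_apply, ← map_mul]
      rw [Algebra.commutes])

/-- The idempotent `e₀` (at the source) in `A`. -/
def e0 : Alg T := mkA T (eV Vtx.src)

/-- The idempotent `e∞` (at the sink) in `A`. -/
def einf : Alg T := mkA T (eV Vtx.snk)

/-- The `k`-linear map `A → A`, `x ↦ e₀ * x * e∞`, whose range is `e₀ A e∞`. -/
def lrMap : Alg T →ₗ[k] Alg T where
  toFun x := e0 T * x * einf T
  map_add' x y := by simp [mul_add, add_mul]
  map_smul' c x := by
    simp only [RingHom.id_apply]
    rw [mul_smul_comm, smul_mul_assoc]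

/-- `m = dim_k e₀ A e∞`, the dimension of the span of the (residues of the) paths from
the source to the sink. -/
def mDim : ℕ := Module.finrank k ↥(LinearMap.range (lrMap T))

/-- The branch `w i` lies in the ideal `I`. -/
def branchInI (i : Fin T.t) : Prop := wE i ∈ T.I

/-- A minimal relation: `∑_{i ∈ J} λ i • w i ∈ I` with `|J| ≥ 2`, all `λ i ≠ 0`, and no
nonempty proper subsum in `I`. -/
def MinRel (J : Finset (Fin T.t)) (lam : Fin T.t → k) : Prop :=
  2 ≤ J.card ∧ (∀ i ∈ J, lam i ≠ 0) ∧ (∑ i ∈ J, lam i • wE i) ∈ T.I ∧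
    ∀ J' ⊂ J, J'.Nonempty → (∑ i ∈ J', lam i • wE i) ∉ T.I

/-- A toupie algebra is simply connected if any two distinct branches are involved in a
common minimal relation. -/
def SimplyConnected : Prop :=
  ∀ i j : Fin T.t, i ≠ j → ∃ J lam, MinRel T J lam ∧ i ∈ J ∧ j ∈ J

/-- A (minimal) zero-relation on branch `i`: the subpath of branch `i` from its `a`-th
to its `b`-th vertex lies in `I`, but no proper subpath of it does. -/
def ZeroRel (i : Fin T.t) (a b : ℕ) : Prop :=
  a < b ∧ b ≤ T.ℓ i ∧ subE i a b ∈ T.I ∧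
    ∀ a' b', a ≤ a' → b' ≤ b → a' < b' → (a', b') ≠ (a, b) → subE i a' b' ∉ T.I

/-- There is exactly one relation on branch `i`. -/
def ExactlyOneRel (i : Fin T.t) : Prop := ∃! p : ℕ × ℕ, ZeroRel T i p.1 p.2

/-- Branch `i` carries more than one relation. -/
def MoreThanOneRel (i : Fin T.t) : Prop :=
  ∃ p q : ℕ × ℕ, p ≠ q ∧ ZeroRel T i p.1 p.2 ∧ ZeroRel T i q.1 q.2

/-- At most one branch of `Q` has length at least three. -/
def AtMostOneLongBranch : Prop := ∀ i j : Fin T.t, 3 ≤ T.ℓ i → 3 ≤ T.ℓ j → i = j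

/-- The two-sided ideal `I` is generated by the set `S`. -/
def IsGenBy {R : Type u} [Ring R] (I : TwoSidedIdeal R) (S : Set R) : Prop :=
  S ⊆ (I : Set R) ∧ ∀ J : TwoSidedIdeal R, S ⊆ (J : Set R) → (I : Set R) ⊆ (J : Set R)

/-- A toupie algebra is canonical if (after choosing two distinguished branches `i₁, i₂`)
its ideal is generated by `{w i₁ + λ j • w i₂ - w j}` over the remaining branches `j`,
with the `λ j` pairwise distinct and nonzero. -/
def IsCanonical : Prop :=
  ∃ (i₁ i₂ : Fin T.t) (lam : Fin T.t → k), i₁ ≠ i₂ ∧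
    (∀ j, j ≠ i₁ → j ≠ i₂ → lam j ≠ 0) ∧
    (∀ j j', j ≠ i₁ → j ≠ i₂ → j' ≠ i₁ → j' ≠ i₂ → j ≠ j' → lam j ≠ lam j') ∧
    IsGenBy T.I {x | ∃ j, j ≠ i₁ ∧ j ≠ i₂ ∧ x = wE i₁ + lam j • wE i₂ - wE j}

end Toupie
namespace Toupie

/-! ### Module-theoretic notions over an arbitrary ring

Following the paper, all modules are finite-dimensional *right* modules; a right
`A`-module is formalized as a (left) module over `Aᵐᵒᵖ`.  The definitions below are
stated for modules over an arbitrary ring `R` and are applied with `R := Aᵐᵒᵖ`. -/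

variable (R : Type u) [Ring R]

/-- A module is indecomposable if it is nonzero and its only idempotent endomorphisms
are `0` and the identity. -/
def Indec (M : ModuleCat.{u} R) : Prop :=
  Nontrivial M ∧ ∀ f : M →ₗ[R] M, f.comp f = f → f = 0 ∨ f = LinearMap.id

/-- Finiteness ("finite dimensionality") of a module. -/
def FdMod (M : ModuleCat.{u} R) : Prop := Module.Finite R M

/-- `M` has projective dimension at most one: it is the quotient of a projective module
by a projective submodule. -/
def PdLeOne (M : ModuleCat.{u} R) : Prop :=
  ∃ (P : ModuleCat.{u} R) (f : P →ₗ[R] M), Function.Surjective f ∧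
    Module.Projective R P ∧ Module.Projective R ↥(LinearMap.ker f)

/-- `M` has injective dimension at most one: it embeds in an injective module with
injective cokernel. -/
def IdLeOne (M : ModuleCat.{u} R) : Prop :=
  ∃ (E : ModuleCat.{u} R) (f : M →ₗ[R] E), Function.Injective f ∧
    Module.Injective R E ∧ Module.Injective R (E ⧸ LinearMap.range f)

/-- One step of a path in `ind R`: a nonzero non-isomorphism between (finite-dimensional)
indecomposable modules. -/
def Step (M N : ModuleCat.{u} R) : Prop :=
  Indec R M ∧ FdMod R M ∧ Indec R N ∧ FdMod R N ∧
    ∃ f : M →ₗ[R] N, f ≠ 0 ∧ ¬ Function.Bijective f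

/-- A path in `ind R` from `M` to `N` (possibly trivial): a chain
`M = M₀ → M₁ → ⋯ → Mₙ = N` of nonzero non-isomorphisms between indecomposables. -/
def IndPath (M N : ModuleCat.{u} R) : Prop := Relation.ReflTransGen (Step R) M N

/-- The left part `L_R`: the indecomposable (finite-dimensional) modules `M` such that
every indecomposable `X` with a path `X ⇝ M` in `ind R` has projective dimension `≤ 1`. -/
def InLeftPart (M : ModuleCat.{u} R) : Prop :=
  Indec R M ∧ FdMod R M ∧
    ∀ X : ModuleCat.{u} R, Indec R X → FdMod R X → IndPath R X M → PdLeOne R X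

/-- The right part `R_R`: the indecomposable (finite-dimensional) modules `M` such that
every indecomposable `X` with a path `M ⇝ X` in `ind R` has injective dimension `≤ 1`. -/
def InRightPart (M : ModuleCat.{u} R) : Prop :=
  Indec R M ∧ FdMod R M ∧
    ∀ X : ModuleCat.{u} R, Indec R X → FdMod R X → IndPath R M X → IdLeOne R X

/-- Hereditary: global dimension at most one, i.e. every module has projective dimension
at most one. -/
def Hereditary : Prop := ∀ M : ModuleCat.{u} R, PdLeOne R M

/-- Quasitilted: every indecomposable projective module lies in the left part. -/
def Quasitilted : Prop :=
  ∀ P : ModuleCat.{u} R, Indec R P → FdMod R P → Module.Projective R P → InLeftPart R P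

/-- A module is directed if it lies on no cycle of nonzero non-isomorphisms between
indecomposables in `ind R`. -/
def Directed (M : ModuleCat.{u} R) : Prop := ¬ Relation.TransGen (Step R) M M

/-- Weakly shod: every indecomposable (finite-dimensional) module not lying in
`L_R ∪ R_R` is directed. -/
def WeaklyShod : Prop :=
  ∀ M : ModuleCat.{u} R, Indec R M → FdMod R M →
    ¬ InLeftPart R M → ¬ InRightPart R M → Directed R M

/-- Laura: all but finitely many isomorphism classes of indecomposable
(finite-dimensional) modules lie in `L_R ∪ R_R`. -/
def Laura : Prop :=
  ∃ S : Set (ModuleCat.{u} R), S.Finite ∧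
    ∀ M : ModuleCat.{u} R, Indec R M → FdMod R M →
      ¬ InLeftPart R M → ¬ InRightPart R M → ∃ N ∈ S, Nonempty (M ≃ₗ[R] N)

/-- There are exactly `n` isomorphism classes of modules satisfying `P`. -/
def NumClasses (P : ModuleCat.{u} R → Prop) (n : ℕ) : Prop :=
  ∃ f : Fin n → ModuleCat.{u} R, (∀ i, P (f i)) ∧
    (∀ i j, Nonempty ((f i : Type u) ≃ₗ[R] (f j : Type u)) → i = j) ∧
    ∀ M : ModuleCat.{u} R, P M → ∃ i, Nonempty ((M : Type u) ≃ₗ[R] (f i : Type u))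

/-- `M` is (isomorphic to) a direct summand of `T`. -/
def IsSummandOf (T : Type u) [AddCommGroup T] [Module R T] (M : ModuleCat.{u} R) : Prop :=
  ∃ N N' : Submodule R T, IsCompl N N' ∧ Nonempty ((M : Type u) ≃ₗ[R] N)

/-- `Ext¹_R(T, T) = 0`: every self-extension `0 → T → E → T → 0` splits. -/
def SelfExtVanish (T : Type u) [AddCommGroup T] [Module R T] : Prop :=
  ∀ (E : Type u) [AddCommGroup E] [Module R E] (ι : T →ₗ[R] E) (π : E →ₗ[R] T),
    Function.Injective ι → Function.Surjective π → LinearMap.range ι = LinearMap.ker π →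
      ∃ s : T →ₗ[R] E, π.comp s = LinearMap.id

/-- A tilting module over a hereditary algebra: a finite module with `Ext¹(T,T) = 0`
having as many pairwise non-isomorphic indecomposable direct summands as there are
simple modules. -/
def IsTiltingMod (T : Type u) [AddCommGroup T] [Module R T] : Prop :=
  Module.Finite R T ∧ SelfExtVanish R T ∧
    ∃ n : ℕ, NumClasses R (fun M => Indec R M ∧ IsSummandOf R T M) n ∧
      NumClasses R (fun M => IsSimpleModule R M) n

variable (k : Type u) [Field k]

/-- A `k`-algebra `A` is tilted if it is the endomorphism algebra of a tilting (right)
module over a hereditary finite-dimensional `k`-algebra `H`.  (Right `H`-modules are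
modules over `Hᵐᵒᵖ`; the isomorphism `A ≅ End_H T` is a `k`-linear ring isomorphism.) -/
def IsTilted (A : Type u) [Ring A] [Algebra k A] : Prop :=
  ∃ (H : Type u) (_ : Ring H) (_ : Algebra k H),
    FiniteDimensional k H ∧ Hereditary Hᵐᵒᵖ ∧
      ∃ (T : Type u) (_ : AddCommGroup T) (_ : Module Hᵐᵒᵖ T),
        IsTiltingMod Hᵐᵒᵖ T ∧
          ∃ (_ : Module k T) (_ : SMulCommClass Hᵐᵒᵖ k T) (_ : IsScalarTower k Hᵐᵒᵖ T)
            (φ : A ≃+* Module.End Hᵐᵒᵖ T), ∀ (c : k) (x : A), φ (c • x) = c • φ x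

end Toupie
namespace Toupie

variable {k : Type u} [Field k] (T : ToupieAlg k)

/-! ### Right `A`-modules as representations of `(Q, I)`

For a right `A`-module `M` (a module over `Aᵐᵒᵖ`) and a vertex `v`, the space of the
corresponding representation at `v` is `M_v = M • e_v`. -/

/-- The action of the idempotent `e_v ∈ A` on a right `A`-module (= `Aᵐᵒᵖ`-module). -/
def actV (v : Vtx T.t T.ℓ) : (Alg T)ᵐᵒᵖ := op (mkA T (eV v))

/-- The space `M_v = M • e_v` of the representation `M` at the vertex `v` is zero. -/
def VanishAt (M : ModuleCat.{u} (Alg T)ᵐᵒᵖ) (v : Vtx T.t T.ℓ) : Prop :=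
  ∀ m : M, actV T v • m = 0

/-- Every simple summand of `top M = M / rad M` is one of the simple modules `S_v`,
`v ∈ vs`: for every maximal submodule `N` the simple quotient `M/N` is supported at some
vertex of `vs` (for an admissible quotient of a path algebra, the simple module `S_v` is
the unique simple on which `e_v` acts nontrivially). -/
def TopIn (M : ModuleCat.{u} (Alg T)ᵐᵒᵖ) (vs : Set (Vtx T.t T.ℓ)) : Prop :=
  ∀ N : Submodule (Alg T)ᵐᵒᵖ M, IsCoatom N → ∃ v ∈ vs, ∃ m : M, actV T v • m ∉ N

/-- Every simple summand of the socle of `M` is one of the simple modules `S_v`,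
`v ∈ vs`: every simple submodule `N ≤ M` is supported at some vertex of `vs`. -/
def SocIn (M : ModuleCat.{u} (Alg T)ᵐᵒᵖ) (vs : Set (Vtx T.t T.ℓ)) : Prop :=
  ∀ N : Submodule (Alg T)ᵐᵒᵖ M, IsAtom N → ∃ v ∈ vs, ∃ m ∈ N, actV T v • m ≠ 0

/-- The module `D x y` (for two positions `0 ≤ x, y ≤ ℓ i₀` on the unique branch `i₀`
lying in `I`, and an auxiliary branch `i₂ ≠ i₀`): the right `A`-module with generators
`g = e₀` (at the source) and `h = e_y` (at the `y`-th vertex of branch `i₀`), subject to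
the relations `g ⬝ (subpath of w i₀ from 0 to x+1) = 0` and
`g ⬝ w i₂ = h ⬝ (subpath of w i₀ from y to ℓ i₀)`.  It is presented as the quotient of
the right regular module `A ⊕ A` by the right submodule generated by
`(1 - e₀, 0)`, `(0, 1 - e_y)`, `(subE i₀ 0 (min (x+1) (ℓ i₀)), 0)` and
`(w i₂, - subE i₀ y (ℓ i₀))`. -/
abbrev Dmod (i₀ i₂ : Fin T.t) (x y : ℕ) : Type u :=
  (Alg T × Alg T) ⧸ Submodule.span (Alg T)ᵐᵒᵖ
    ({((mkA T (1 - eV Vtx.src) : Alg T), (0 : Alg T)),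
      ((0 : Alg T), (mkA T (1 - eV (vtx T.t T.ℓ i₀ y)) : Alg T)),
      ((mkA T (subE i₀ 0 (min (x + 1) (T.ℓ i₀))) : Alg T), (0 : Alg T)),
      ((mkA T (wE i₂) : Alg T), (- mkA T (subE i₀ y (T.ℓ i₀)) : Alg T))} :
        Set (Alg T × Alg T))

end Toupie

namespace Toupie

section Paths

variable {k : Type u} [Field k] {t : ℕ} {ℓ : Fin t → ℕ}

/-- The vertices of a toupie quiver, as a nested option type. -/
def vtxEquiv (t : ℕ) (ℓ : Fin t → ℕ) :
    Vtx t ℓ ≃ Option (Option (Σ i : Fin t, Fin (ℓ i - 1))) where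
  toFun
    | .src => none
    | .snk => some none
    | .mid i a => some (some ⟨i, a⟩)
  invFun
    | none => .src
    | some none => .snk
    | some (some ⟨i, a⟩) => .mid i a
  left_inv v := by cases v <;> rfl
  right_inv v := by rcases v with _ | _ | ⟨i, a⟩ <;> rfl

instance : Fintype (Vtx t ℓ) := Fintype.ofEquiv _ (vtxEquiv t ℓ).symm

@[simp] lemma vtx_zero (i : Fin t) : vtx t ℓ i 0 = .src := by simp [vtx]

lemma vtx_last (hℓ : ∀ i, 1 ≤ ℓ i) (i : Fin t) : vtx t ℓ i (ℓ i) = .snk := by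
  have := hℓ i
  simp [vtx, show ℓ i ≠ 0 by omega]

lemma vtx_mid (i : Fin t) (a : Fin (ℓ i - 1)) : vtx t ℓ i (a + 1) = .mid i a := by
  simp [vtx]

lemma exists_eq_vtx (hℓ : ∀ i, 1 ≤ ℓ i) (i₀ : Fin t) (v : Vtx t ℓ) :
    ∃ i a, a ≤ ℓ i ∧ v = vtx t ℓ i a := by
  cases v with
  | src => exact ⟨i₀, 0, Nat.zero_le _, by simp⟩
  | snk => exact ⟨i₀, ℓ i₀, le_rfl, (vtx_last hℓ i₀).symm⟩
  | mid i a => exact ⟨i, a + 1, by omega, (vtx_mid i a).symm⟩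

/-- A family indexed by positions on branches which agrees at the source and at the sink
comes from a family indexed by vertices. -/
lemma exists_vertex_family {α : Type*} (hℓ : ∀ i, 1 ≤ ℓ i) (G : Fin t → ℕ → α) (s e : α)
    (hs : ∀ i, G i 0 = s) (he : ∀ i, G i (ℓ i) = e) :
    ∃ F : Vtx t ℓ → α, ∀ i a, a ≤ ℓ i → F (vtx t ℓ i a) = G i a := by
  refine ⟨fun v => match v with
    | .src => s
    | .snk => e
    | .mid i a => G i (a + 1), fun i a ha => ?_⟩
  rcases Nat.eq_zero_or_pos a with rfl | h0
  · simp [hs]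
  rcases ha.eq_or_lt with rfl | h1
  · rw [vtx_last hℓ, he]
  · have := vtx_mid i (⟨a - 1, by omega⟩ : Fin (ℓ i - 1))
    simp only [Nat.sub_add_cancel h0] at this
    rw [this]
    simp only [Nat.sub_add_cancel h0]

lemma Ev_mul_self (v : Vtx t ℓ) : Ev k v * Ev k v = Ev k v := by
  ext f p
  simp +contextual [Ev]

lemma Ev_mul_of_ne {v w : Vtx t ℓ} (h : v ≠ w) : Ev k v * Ev k w = 0 := by
  ext f p
  simp only [Ev, Module.End.mul_apply, LinearMap.coe_mk, AddHom.coe_mk, LinearMap.zero_apply,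
    Pi.zero_apply]
  split_ifs <;> simp_all

lemma sum_Ev : ∑ v : Vtx t ℓ, Ev k v = 1 := by
  ext f p
  simp only [Ev, LinearMap.sum_apply, Finset.sum_apply, LinearMap.coe_mk, AddHom.coe_mk,
    Module.End.one_apply]
  simp

lemma startIdx_of_strip {i : Fin t} {j : ℕ} {p q : PIdx t ℓ} (h : strip i j p = some q) :
    startIdx p = vtx t ℓ i j ∧ startIdx q = vtx t ℓ i (j + 1) := by
  cases p with
  | vert v => simp [strip] at h
  | sub i' a b hab hb =>
    simp only [strip] at h
    split_ifs at h with h1 h2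
    · obtain ⟨rfl, rfl⟩ := h1
      simp only [Option.some.injEq] at h
      subst h
      simp [startIdx]
    · obtain ⟨rfl, rfl⟩ := h1
      simp only [Option.some.injEq] at h
      subst h
      have : b = a + 1 := by omega
      simp [startIdx, this]

lemma Ev_mul_Ar (i : Fin t) (j : ℕ) : Ev k (vtx t ℓ i j) * Ar k i j = Ar k i j := by
  ext f p
  simp only [Ev, Ar, Module.End.mul_apply, LinearMap.coe_mk, AddHom.coe_mk]
  rcases h : strip i j p with _ | q
  · simp
  · simp [(startIdx_of_strip h).1]

lemma Ar_mul_Ev (i : Fin t) (j : ℕ) : Ar k i j * Ev k (vtx t ℓ i (j + 1)) = Ar k i j := by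
  ext f p
  simp only [Ev, Ar, Module.End.mul_apply, LinearMap.coe_mk, AddHom.coe_mk]
  rcases h : strip i j p with _ | q
  · simp
  · simp [(startIdx_of_strip h).2]

lemma Ar_eq_zero {i : Fin t} {j : ℕ} (hj : ℓ i ≤ j) : Ar k (ℓ := ℓ) i j = 0 := by
  ext f p
  simp only [Ar, LinearMap.coe_mk, AddHom.coe_mk, LinearMap.zero_apply, Pi.zero_apply]
  cases p with
  | vert v => simp [strip]
  | sub i' a b hab hb =>
    rw [strip, dif_neg]
    · simp
    · rintro ⟨rfl, rfl⟩
      omega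

lemma eV_mul_self (v : Vtx t ℓ) : (eV v * eV v : PathAlg k t ℓ) = eV v :=
  Subtype.ext (Ev_mul_self v)

lemma eV_mul_of_ne {v w : Vtx t ℓ} (h : v ≠ w) : (eV v * eV w : PathAlg k t ℓ) = 0 :=
  Subtype.ext (Ev_mul_of_ne h)

lemma sum_eV : ∑ v : Vtx t ℓ, (eV v : PathAlg k t ℓ) = 1 :=
  Subtype.ext (by simpa [eV] using sum_Ev)

lemma eV_mul_arE (i : Fin t) (j : ℕ) :
    (eV (vtx t ℓ i j) * arE i j : PathAlg k t ℓ) = arE i j :=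
  Subtype.ext (Ev_mul_Ar i j)

lemma arE_mul_eV (i : Fin t) (j : ℕ) :
    (arE i j * eV (vtx t ℓ i (j + 1)) : PathAlg k t ℓ) = arE i j :=
  Subtype.ext (Ar_mul_Ev i j)

lemma arE_eq_zero {i : Fin t} {j : ℕ} (hj : ℓ i ≤ j) : (arE i j : PathAlg k t ℓ) = 0 :=
  Subtype.ext (Ar_eq_zero hj)

@[simp] lemma subE_self (i : Fin t) (a : ℕ) : (subE i a a : PathAlg k t ℓ) = 1 := by
  simp [subE]

lemma subE_succ (i : Fin t) {a b : ℕ} (h : a ≤ b) :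
    (subE i a (b + 1) : PathAlg k t ℓ) = subE i a b * arE i b := by
  simp [subE, Nat.succ_sub h, List.range_succ, Nat.add_sub_cancel' h]

lemma subE_mul_subE (i : Fin t) {a b c : ℕ} (h : a ≤ b) (h' : b ≤ c) :
    (subE i a b * subE i b c : PathAlg k t ℓ) = subE i a c := by
  induction c, h' using Nat.le_induction with
  | base => simp
  | succ c hc ih => rw [subE_succ i hc, ← mul_assoc, ih, subE_succ i (h.trans hc)]

lemma subE_single (i : Fin t) (a : ℕ) : (subE i a (a + 1) : PathAlg k t ℓ) = arE i a := by
  rw [subE_succ i le_rfl, subE_self, one_mul]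

lemma eV_mul_subE (i : Fin t) {a b : ℕ} (h : a < b) :
    (eV (vtx t ℓ i a) * subE i a b : PathAlg k t ℓ) = subE i a b := by
  rw [← subE_mul_subE i (Nat.le_succ a) h, subE_single, ← mul_assoc, eV_mul_arE]

lemma eV_mul_subE_mul_eV (i : Fin t) {a b : ℕ} (h : a ≤ b) :
    (eV (vtx t ℓ i a) * subE i a b * eV (vtx t ℓ i b) : PathAlg k t ℓ)
      = eV (vtx t ℓ i a) * subE i a b := by
  rcases h.eq_or_lt with rfl | h
  · simp [eV_mul_self]
  · obtain ⟨b, rfl⟩ : ∃ c, b = c + 1 := ⟨b - 1, by omega⟩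
    rw [subE_succ i (by omega), mul_assoc, mul_assoc, arE_mul_eV]

/-- Induction principle for the path algebra. -/
lemma pathAlg_induction {P : PathAlg k t ℓ → Prop} (heV : ∀ v, P (eV v))
    (harE : ∀ i j, P (arE i j)) (halg : ∀ c : k, P (algebraMap k _ c))
    (hadd : ∀ p q, P p → P q → P (p + q)) (hmul : ∀ p q, P p → P q → P (p * q))
    (p : PathAlg k t ℓ) : P p := by
  obtain ⟨x, hx⟩ := p
  induction hx using Algebra.adjoin_induction with
  | mem x hx =>
    rcases hx with ⟨v, rfl⟩ | ⟨i, j, rfl⟩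
    · exact heV v
    · exact harE i j
  | algebraMap c => exact halg c
  | add x y hx hy h1 h2 => exact hadd _ _ h1 h2
  | mul x y hx hy h1 h2 => exact hmul _ _ h1 h2

end Paths

section LinearAlgebra

variable {k : Type*} [Field k] {V : Type*} [AddCommGroup V] [Module k V]

/-- A projection onto `X(L)` lifts along `X` to a projection onto `L`. -/
lemma exists_projection_lift (X P' : V →ₗ[k] V) (L L' : Submodule k V) (hL : L.map X = L')
    (hr : ∀ m, P' m ∈ L') (hid : ∀ m ∈ L', P' m = m) :
    ∃ P : V →ₗ[k] V, (∀ m, P m ∈ L) ∧ (∀ m ∈ L, P m = m) ∧ ∀ m, X (P m) = P' (X m) := by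
  have hX : ∀ m ∈ L, X m ∈ L' := fun m hm => hL ▸ Submodule.mem_map_of_mem hm
  obtain ⟨σ, hσ⟩ := (X.restrict hX).exists_rightInverse_of_surjective (by
    rw [LinearMap.range_eq_top]
    rintro ⟨z, hz⟩
    rw [← hL] at hz
    obtain ⟨m, hm, rfl⟩ := hz
    exact ⟨⟨m, hm⟩, rfl⟩)
  have hσ' : ∀ z : L', X (σ z) = z := fun z =>
    congrArg Subtype.val (LinearMap.congr_fun hσ z)
  obtain ⟨π, hπ⟩ := L.subtype.exists_leftInverse_of_injective (by simp)
  have hπ' : ∀ z (hz : z ∈ L), π z = ⟨z, hz⟩ := fun z hz => LinearMap.congr_fun hπ ⟨z, hz⟩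
  let c : V →ₗ[k] L' := (P'.comp X).codRestrict L' fun m => hr _
  refine ⟨L.subtype.comp (σ.comp c + (π - σ.comp ((X.restrict hX).comp π))), ?_, ?_, ?_⟩
  · intro m
    exact SetLike.coe_mem ((σ.comp c + (π - σ.comp ((X.restrict hX).comp π))) m)
  · intro m hm
    have : c m = X.restrict hX (π m) := by
      apply Subtype.ext
      simp [c, hπ' m hm, hid _ (hX m hm)]
    simp [this, hπ' m hm]
  · intro m
    simp [hσ', c]

/-- A sequence of linear maps starting on `V₀` with zero composite splits compatibly into the part
generated by `V₀` and a complement. -/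
lemma exists_projection_sequence (X : ℕ → V →ₗ[k] V) (L : ℕ → Submodule k V) (n : ℕ)
    (hL : ∀ a < n, (L a).map (X a) = L (a + 1)) (hn : L n = ⊥) :
    ∃ P : ℕ → V →ₗ[k] V, (∀ a ≤ n, ∀ m, P a m ∈ L a) ∧ (∀ a ≤ n, ∀ m ∈ L a, P a m = m) ∧
      ∀ a < n, ∀ m, X a (P a m) = P (a + 1) (X a m) := by
  suffices H : ∀ d ≤ n, ∃ P : ℕ → V →ₗ[k] V, (∀ a ≤ n, n ≤ a + d → ∀ m, P a m ∈ L a) ∧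
      (∀ a ≤ n, n ≤ a + d → ∀ m ∈ L a, P a m = m) ∧
      ∀ a < n, n ≤ a + d → ∀ m, X a (P a m) = P (a + 1) (X a m) by
    obtain ⟨P, h1, h2, h3⟩ := H n le_rfl
    exact ⟨P, fun a ha => h1 a ha (by omega), fun a ha => h2 a ha (by omega),
      fun a ha => h3 a ha (by omega)⟩
  intro d
  induction d with
  | zero =>
    intro _
    refine ⟨fun _ => 0, fun a ha hb m => by simp, fun a ha hb m hm => ?_,
      fun a ha hb => by omega⟩
    obtain rfl : a = n := by omega
    rw [hn, Submodule.mem_bot] at hm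
    simp [hm]
  | succ d ih =>
    intro hd
    obtain ⟨P, h1, h2, h3⟩ := ih (by omega)
    obtain ⟨b, hb⟩ : ∃ b, b + (d + 1) = n := ⟨n - (d + 1), by omega⟩
    obtain ⟨Q, q1, q2, q3⟩ := exists_projection_lift (X b) (P (b + 1)) (L b) (L (b + 1))
      (hL b (by omega)) (h1 _ (by omega) (by omega)) (h2 _ (by omega) (by omega))
    refine ⟨Function.update P b Q, fun a ha hab => ?_, fun a ha hab => ?_, fun a ha hab => ?_⟩
    · rcases eq_or_ne a b with rfl | hne
      · simpa using q1
      · simpa [hne] using h1 a ha (by omega)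
    · rcases eq_or_ne a b with rfl | hne
      · simpa using q2
      · simpa [hne] using h2 a ha (by omega)
    · have hne' : a + 1 ≠ b := by omega
      rcases eq_or_ne a b with rfl | hne
      · simpa using q3
      · simpa [hne, hne'] using h3 a ha (by omega)

/-- A linear functional vanishing on the kernel of a linear map factors through it. -/
lemma exists_functional_factor {U : Type*} [AddCommGroup U] [Module k U] (g : U →ₗ[k] V)
    (θ : U →ₗ[k] k) (h : ∀ z, g z = 0 → θ z = 0) : ∃ ψ : V →ₗ[k] k, ∀ z, ψ (g z) = θ z := by
  have : θ ∈ LinearMap.range g.dualMap := by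
    rw [LinearMap.range_dualMap_eq_dualAnnihilator_ker, Submodule.mem_dualAnnihilator]
    exact fun z hz => h z (LinearMap.mem_ker.1 hz)
  obtain ⟨ψ, hψ⟩ := this
  exact ⟨ψ, fun z => LinearMap.congr_fun hψ z⟩

/-- A vector outside a subspace is separated from it by a linear functional. -/
lemma exists_functional_separating (J : Submodule k V) {u : V} (hu : u ∉ J) :
    ∃ φ : V →ₗ[k] k, φ u = 1 ∧ ∀ m ∈ J, φ m = 0 := by
  obtain ⟨φ, h1, h2⟩ := Submodule.exists_le_ker_of_notMem hu
  refine ⟨(φ u)⁻¹ • φ, by simp [h1], fun m hm => ?_⟩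
  simp [LinearMap.mem_ker.1 (h2 hm)]

end LinearAlgebra

section Modules

variable {k : Type u} [Field k] {T : ToupieAlg k}
variable {M : Type*} [AddCommGroup M] [Module (Alg T)ᵐᵒᵖ M] [Module k M]
  [IsScalarTower k (Alg T)ᵐᵒᵖ M]

lemma mkA_smul (c : k) (p : PathAlg k T.t T.ℓ) : mkA T (c • p) = c • mkA T p := by
  rw [Algebra.smul_def, map_mul, Algebra.smul_def]
  rfl

lemma mkA_eq_zero_of_mem {p : PathAlg k T.t T.ℓ} (h : p ∈ T.I) : mkA T p = 0 :=
  (RingCon.eq T.I.ringCon).2 ((TwoSidedIdeal.mem_iff T.I p).1 h)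

lemma mem_of_mkA_eq_zero {p : PathAlg k T.t T.ℓ} (h : mkA T p = 0) : p ∈ T.I :=
  (TwoSidedIdeal.mem_iff T.I p).2 ((RingCon.eq T.I.ringCon).1 h)

/-- The right action of an element of the path algebra on an `A`-module. -/
def act (T : ToupieAlg k) (M : Type*) [AddCommGroup M] [Module (Alg T)ᵐᵒᵖ M] [Module k M]
    [IsScalarTower k (Alg T)ᵐᵒᵖ M] (p : PathAlg k T.t T.ℓ) : M →ₗ[k] M where
  toFun m := op (mkA T p) • m
  map_add' m n := smul_add _ m n
  map_smul' c m := smul_comm _ c m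

lemma act_apply (p : PathAlg k T.t T.ℓ) (m : M) : act T M p m = op (mkA T p) • m := rfl

lemma act_mul (p q : PathAlg k T.t T.ℓ) (m : M) : act T M (p * q) m = act T M q (act T M p m) := by
  simp [act_apply, mul_smul]

@[simp] lemma act_one (m : M) : act T M (1 : PathAlg k T.t T.ℓ) m = m := by
  simp [act_apply]

@[simp] lemma act_zero (m : M) : act T M (0 : PathAlg k T.t T.ℓ) m = 0 := by
  simp [act_apply]

lemma act_add (p q : PathAlg k T.t T.ℓ) (m : M) : act T M (p + q) m = act T M p m + act T M q m := by
  simp [act_apply, add_smul]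

lemma act_algebraMap (c : k) (m : M) : act T M (algebraMap k (PathAlg k T.t T.ℓ) c) m = c • m := by
  rw [Algebra.algebraMap_eq_smul_one, act_apply, mkA_smul, map_one, op_smul, op_one, smul_assoc,
    one_smul]

lemma act_of_mkA_eq_smul {p q : PathAlg k T.t T.ℓ} {c : k} (h : mkA T p = c • mkA T q) (m : M) :
    act T M p m = c • act T M q m := by
  rw [act_apply, act_apply, h, op_smul, smul_assoc]

lemma exists_act_eq_smul (r : (Alg T)ᵐᵒᵖ) :
    ∃ p : PathAlg k T.t T.ℓ, ∀ m : M, r • m = act T M p m := by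
  obtain ⟨p, hp⟩ := mkA_surjective T r.unop
  exact ⟨p, fun m => by rw [act_apply, hp, op_unop]⟩

lemma act_sum {ι : Type*} (s : Finset ι) (p : ι → PathAlg k T.t T.ℓ) (m : M) :
    act T M (∑ j ∈ s, p j) m = ∑ j ∈ s, act T M (p j) m := by
  induction s using Finset.induction_on with
  | empty => simp
  | insert a s ha ih => rw [Finset.sum_insert ha, Finset.sum_insert ha, act_add, ih]

variable (T) in
lemma sum_act_eV (m : M) : ∑ v : Vtx T.t T.ℓ, act T M (eV v) m = m := by
  rw [← act_sum, sum_eV, act_one]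

/-- The space `M_v` of the representation at a vertex. -/
def space (T : ToupieAlg k) (M : Type*) [AddCommGroup M] [Module (Alg T)ᵐᵒᵖ M] [Module k M]
    [IsScalarTower k (Alg T)ᵐᵒᵖ M] (v : Vtx T.t T.ℓ) : Submodule k M :=
  LinearMap.eqLocus (act T M (eV v)) LinearMap.id

lemma mem_space {v : Vtx T.t T.ℓ} {m : M} : m ∈ space T M v ↔ act T M (eV v) m = m := Iff.rfl

lemma act_eV_mem (v : Vtx T.t T.ℓ) (m : M) : act T M (eV v) m ∈ space T M v := by
  rw [mem_space, ← act_mul, eV_mul_self]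

lemma act_eV_of_ne {v w : Vtx T.t T.ℓ} (h : v ≠ w) {m : M} (hm : m ∈ space T M v) :
    act T M (eV w) m = 0 := by
  rw [← mem_space.1 hm, ← act_mul, eV_mul_of_ne h, act_zero]

lemma act_arE_mem (i : Fin T.t) (j : ℕ) (m : M) :
    act T M (arE i j) m ∈ space T M (vtx T.t T.ℓ i (j + 1)) := by
  rw [mem_space, ← act_mul, arE_mul_eV]

lemma act_arE_eV (i : Fin T.t) (j : ℕ) (m : M) :
    act T M (arE i j) (act T M (eV (vtx T.t T.ℓ i j)) m) = act T M (arE i j) m := by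
  rw [← act_mul, eV_mul_arE]

lemma act_subE_mem (i : Fin T.t) {a b : ℕ} (h : a ≤ b) {m : M}
    (hm : m ∈ space T M (vtx T.t T.ℓ i a)) :
    act T M (subE i a b) m ∈ space T M (vtx T.t T.ℓ i b) := by
  rw [mem_space, ← mem_space.1 hm, ← act_mul, ← act_mul, ← mul_assoc, eV_mul_subE_mul_eV i h,
    act_mul]

lemma act_subE_subE (i : Fin T.t) {a b c : ℕ} (h : a ≤ b) (h' : b ≤ c) (m : M) :
    act T M (subE i b c) (act T M (subE i a b) m) = act T M (subE i a c) m := by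
  rw [← act_mul, subE_mul_subE i h h']

lemma act_arE_subE (i : Fin T.t) {a b : ℕ} (h : a ≤ b) (m : M) :
    act T M (arE i b) (act T M (subE i a b) m) = act T M (subE i a (b + 1)) m := by
  rw [← act_mul, subE_succ i h]

lemma act_subE_arE (i : Fin T.t) {a b : ℕ} (h : a < b) (m : M) :
    act T M (subE i (a + 1) b) (act T M (arE i a) m) = act T M (subE i a b) m := by
  rw [← act_mul, ← subE_single, subE_mul_subE i (Nat.le_succ a) h]

variable (T) in
/-- Two linear maps agree if they agree on the spaces at all vertices. -/
lemma eq_of_forall_space {N : Type*} [AddCommGroup N] (f g : M →+ N)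
    (h : ∀ i a, a ≤ T.ℓ i → ∀ m ∈ space T M (vtx T.t T.ℓ i a), f m = g m) (m : M) : f m = g m := by
  rw [← sum_act_eV T m, map_sum, map_sum]
  refine Finset.sum_congr rfl fun v _ => ?_
  obtain ⟨i, a, ha, rfl⟩ := exists_eq_vtx T.hℓ ⟨0, by have := T.ht; omega⟩ v
  exact h i a ha _ (act_eV_mem _ m)

/-- A `k`-linear map commuting with trivial paths and arrows is `A`-linear. -/
lemma map_act_of_generators (f : M →ₗ[k] M)
    (hv : ∀ v m, f (act T M (eV v) m) = act T M (eV v) (f m))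
    (ha : ∀ i j m, f (act T M (arE i j) m) = act T M (arE i j) (f m))
    (p : PathAlg k T.t T.ℓ) : ∀ m, f (act T M p m) = act T M p (f m) := by
  induction p using pathAlg_induction with
  | heV v => exact hv v
  | harE i j => exact ha i j
  | halg c => intro m; rw [act_algebraMap, act_algebraMap, map_smul]
  | hadd p q hp hq => intro m; rw [act_add, act_add, map_add, hp, hq]
  | hmul p q hp hq => intro m; rw [act_mul, act_mul, hq, hp]

/-- Endomorphisms of `M` are families of linear maps of the spaces at the vertices commuting with
the arrows. -/
lemma exists_endomorphism (G : Fin T.t → ℕ → M →ₗ[k] M)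
    (hG : ∀ i a, a ≤ T.ℓ i → ∀ m ∈ space T M (vtx T.t T.ℓ i a),
      G i a m ∈ space T M (vtx T.t T.ℓ i a))
    (h0 : ∀ i j, ∀ m ∈ space T M .src, G i 0 m = G j 0 m)
    (h1 : ∀ i j, ∀ m ∈ space T M .snk, G i (T.ℓ i) m = G j (T.ℓ j) m)
    (harr : ∀ i a, a < T.ℓ i → ∀ m ∈ space T M (vtx T.t T.ℓ i a),
      act T M (arE i a) (G i a m) = G i (a + 1) (act T M (arE i a) m)) :
    ∃ f : M →ₗ[(Alg T)ᵐᵒᵖ] M, ∀ i a, a ≤ T.ℓ i → ∀ m ∈ space T M (vtx T.t T.ℓ i a),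
      f m = G i a m := by
  let z : Fin T.t := ⟨0, by have := T.ht; omega⟩
  obtain ⟨F, hF⟩ := exists_vertex_family T.hℓ
    (fun i a => (G i a).comp (act T M (eV (vtx T.t T.ℓ i a))))
    ((G z 0).comp (act T M (eV .src))) ((G z (T.ℓ z)).comp (act T M (eV .snk)))
    (fun i => by
      ext m
      simpa using h0 i z _ (act_eV_mem _ m))
    (fun i => by
      ext m
      simpa [vtx_last T.hℓ] using h1 i z _ (act_eV_mem _ m))
  have hFe : ∀ v m, F v (act T M (eV v) m) = F v m := by
    intro v m
    obtain ⟨i, a, ha, rfl⟩ := exists_eq_vtx T.hℓ z v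
    rw [hF i a ha]
    simp [mem_space.1 (act_eV_mem _ m)]
  have hFm : ∀ v m, F v m ∈ space T M v := by
    intro v m
    obtain ⟨i, a, ha, rfl⟩ := exists_eq_vtx T.hℓ z v
    rw [hF i a ha]
    exact hG i a ha _ (act_eV_mem _ m)
  have hF0 : ∀ v w m, v ≠ w → m ∈ space T M v → F w m = 0 := by
    intro v w m h hm
    rw [← hFe, act_eV_of_ne h hm, map_zero]
  let f : M →ₗ[k] M := ∑ v, F v
  have hf : ∀ v, ∀ m ∈ space T M v, f m = F v m := by
    intro v m hm
    simp only [f, LinearMap.sum_apply]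
    exact Finset.sum_eq_single v (fun w _ hw => hF0 v w m hw.symm hm) (by simp)
  have hfe : ∀ v m, act T M (eV v) (f m) = F v m := by
    intro v m
    simp only [f, LinearMap.sum_apply, map_sum]
    rw [Finset.sum_eq_single v (fun w _ hw => act_eV_of_ne hw (hFm w m)) (by simp)]
    exact hFm v m
  have hfa : ∀ p m, f (act T M p m) = act T M p (f m) := by
    apply map_act_of_generators f
    · intro v m
      rw [hf v _ (act_eV_mem v m), hFe, hfe]
    · intro i j m
      rcases lt_or_ge j (T.ℓ i) with hj | hj
      · rw [hf _ _ (act_arE_mem i j m), ← act_arE_eV i j (f m), hfe, hF i (j + 1) hj, hF i j hj.le]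
        simp only [LinearMap.comp_apply]
        rw [mem_space.1 (act_arE_mem i j m), harr i j hj _ (act_eV_mem _ m), act_arE_eV]
      · simp [arE_eq_zero hj]
  refine ⟨{ toFun := f, map_add' := map_add f, map_smul' := fun r m => ?_ }, fun i a ha m hm => ?_⟩
  · obtain ⟨p, hp⟩ := exists_act_eq_smul (M := M) r
    rw [hp, RingHom.id_apply, hp, hfa]
  · change f m = _
    rw [hf _ m hm, hF i a ha, LinearMap.comp_apply, mem_space.1 hm]

/-- If all branches act by zero on `M`, then `M` splits into a part vanishing at the sink and a part
vanishing at the source. -/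
lemma exists_idempotent_of_branches_zero (hw : ∀ i, ∀ m ∈ space T M .src, act T M (wE i) m = 0) :
    ∃ f : M →ₗ[(Alg T)ᵐᵒᵖ] M, f.comp f = f ∧ (∀ m ∈ space T M .src, f m = m) ∧
      ∀ m ∈ space T M .snk, f m = 0 := by
  let L : Fin T.t → ℕ → Submodule k M := fun i a => (space T M .src).map (act T M (subE i 0 a))
  have hL0 : ∀ i, L i 0 = space T M .src := by
    intro i
    ext m
    simp [L]
  have hLl : ∀ i, L i (T.ℓ i) = ⊥ := by
    intro i
    rw [eq_bot_iff]
    rintro _ ⟨m, hm, rfl⟩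
    exact hw i m hm
  have hLs : ∀ i a m, m ∈ L i a → m ∈ space T M (vtx T.t T.ℓ i a) := by
    rintro i a _ ⟨m, hm, rfl⟩
    exact act_subE_mem i (Nat.zero_le a) (by simpa using hm)
  choose P hP1 hP2 hP3 using fun i => exists_projection_sequence (fun a => act T M (arE i a)) (L i)
    (T.ℓ i) (fun a _ => by
      simp only [L]
      rw [← Submodule.map_comp]
      congr 1
      ext m
      exact act_arE_subE i (Nat.zero_le a) m) (hLl i)
  have hP0 : ∀ i, ∀ m ∈ space T M .src, P i 0 m = m := fun i m hm =>
    hP2 i 0 (Nat.zero_le _) m (by rwa [hL0])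
  have hPl : ∀ i m, P i (T.ℓ i) m = 0 := fun i m => by
    have := hP1 i _ le_rfl m
    rwa [hLl, Submodule.mem_bot] at this
  obtain ⟨f, hf⟩ := exists_endomorphism P (fun i a ha m _ => hLs i a _ (hP1 i a ha m))
    (fun i j m hm => by rw [hP0 i m hm, hP0 j m hm]) (fun i j m _ => by rw [hPl, hPl])
    (fun i a ha m _ => hP3 i a ha m)
  let z : Fin T.t := ⟨0, by have := T.ht; omega⟩
  refine ⟨f, LinearMap.ext fun m => ?_, fun m hm => ?_, fun m hm => ?_⟩
  · refine eq_of_forall_space T (f.comp f).toAddMonoidHom f.toAddMonoidHom ?_ m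
    intro i a ha m hm
    change f (f m) = f m
    rw [hf i a ha m hm, hf i a ha _ (hLs i a _ (hP1 i a ha m)), hP2 i a ha _ (hP1 i a ha m)]
  · rw [hf z 0 (Nat.zero_le _) m (by simpa using hm), hP0 z m hm]
  · rw [hf z _ le_rfl m (by simpa [vtx_last T.hℓ] using hm), hPl]

/-- The maximal branch elements other than `w i₀` are nonzero multiples of `w i₂`, and `w i₀`
vanishes in `A`. -/
structure BranchRel (T : ToupieAlg k) (i₀ i₂ : Fin T.t) : Prop where
  ne : i₂ ≠ i₀
  zero : mkA T (wE i₀) = 0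
  smul : ∀ i, i ≠ i₀ → ∃ c : k, c ≠ 0 ∧ mkA T (wE i) = c • mkA T (wE i₂)

lemma lrMap_wE (i : Fin T.t) : lrMap T (mkA T (wE i)) = mkA T (wE i) := by
  have hi := T.hℓ i
  have h : (eV .src * wE i * eV .snk : PathAlg k T.t T.ℓ) = wE i := by
    have h1 := eV_mul_subE_mul_eV (k := k) (ℓ := T.ℓ) i (Nat.zero_le (T.ℓ i))
    have h2 := eV_mul_subE (k := k) (ℓ := T.ℓ) i (a := 0) (b := T.ℓ i) (by omega)
    rw [h2, vtx_last T.hℓ] at h1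
    rw [vtx_zero] at h2
    rw [wE, h2, h1]
  change e0 T * mkA T (wE i) * einf T = _
  rw [e0, einf, ← map_mul, ← map_mul, h]

lemma exists_branchRel (hm : mDim T = 1) (i₀ : Fin T.t) (hb : branchInI T i₀)
    (huniq : ∀ j : Fin T.t, branchInI T j → j = i₀) : ∃ i₂, BranchRel T i₀ i₂ := by
  have : Nontrivial (Fin T.t) := Fin.nontrivial_iff_two_le.2 T.ht
  obtain ⟨i₂, hi₂⟩ := exists_ne i₀
  have hne : ∀ i, i ≠ i₀ → mkA T (wE i) ≠ 0 := fun i hi h =>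
    hi (huniq i (mem_of_mkA_eq_zero h))
  let b : Fin T.t → LinearMap.range (lrMap T) := fun i => ⟨mkA T (wE i), _, lrMap_wE i⟩
  have hbne : b i₂ ≠ 0 := fun h => hne i₂ hi₂ (congrArg Subtype.val h)
  refine ⟨i₂, hi₂, mkA_eq_zero_of_mem hb, fun i hi => ?_⟩
  obtain ⟨c, hc⟩ := (finrank_eq_one_iff_of_nonzero' (b i₂) hbne).1 hm (b i)
  have hc' : c • mkA T (wE i₂) = mkA T (wE i) := congrArg Subtype.val hc
  refine ⟨c, ?_, hc'.symm⟩
  rintro rfl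
  exact hne i hi (by rw [← hc', zero_smul])

/-- Vectors `v` at the source and `h` at the `y`-th vertex of the branch `i₀` whose translates along
the branches form a basis of `M` of the shape prescribed by `D x y`. -/
structure Frame (T : ToupieAlg k) (M : Type*) [AddCommGroup M] [Module (Alg T)ᵐᵒᵖ M] [Module k M]
    [IsScalarTower k (Alg T)ᵐᵒᵖ M] (i₀ i₂ : Fin T.t) (x y : ℕ) (v h : M) : Prop where
  x_lt : x < T.ℓ i₀
  y_pos : 1 ≤ y
  y_le : y ≤ T.ℓ i₀
  v_mem : v ∈ space T M .src
  h_mem : h ∈ space T M (vtx T.t T.ℓ i₀ y)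
  v_succ : act T M (subE i₀ 0 (x + 1)) v = 0
  v_ne : act T M (subE i₀ 0 x) v ≠ 0
  w_ne : act T M (wE i₂) v ≠ 0
  h_eq : act T M (subE i₀ y (T.ℓ i₀)) h = act T M (wE i₂) v
  other : ∀ i, i ≠ i₀ → ∀ a ≤ T.ℓ i, ∀ m ∈ space T M (vtx T.t T.ℓ i a),
    ∃ c : k, m = c • act T M (subE i 0 a) v
  special : ∀ a ≤ T.ℓ i₀, ∀ m ∈ space T M (vtx T.t T.ℓ i₀ a), ∃ c c' : k, (x < a → c = 0) ∧
    (a < y → c' = 0) ∧ m = c • act T M (subE i₀ 0 a) v + c' • act T M (subE i₀ y a) h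

section Splitting

variable {i₀ i₂ : Fin T.t}

lemma BranchRel.act_zero_branch (hr : BranchRel T i₀ i₂) (m : M) : act T M (wE i₀) m = 0 := by
  rw [act_apply, hr.zero, op_zero, zero_smul]

/-- The data splitting off a copy of `D x y` from `M`. -/
lemma exists_splitting_data (hr : BranchRel T i₀ i₂)
    (hw : ∃ m ∈ space T M .src, act T M (wE i₂) m ≠ 0) :
    ∃ (x y : ℕ) (v h : M) (φ ψ : M →ₗ[k] k), x < T.ℓ i₀ ∧ 1 ≤ y ∧ y ≤ T.ℓ i₀ ∧
      v ∈ space T M .src ∧ h ∈ space T M (vtx T.t T.ℓ i₀ y) ∧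
      act T M (subE i₀ 0 (x + 1)) v = 0 ∧
      act T M (subE i₀ y (T.ℓ i₀)) h = act T M (wE i₂) v ∧ φ (act T M (wE i₂) v) = 1 ∧
      (∀ a < y, ∀ m ∈ space T M (vtx T.t T.ℓ i₀ a), φ (act T M (subE i₀ a (T.ℓ i₀)) m) = 0) ∧
      (∀ m ∈ space T M .src, ψ (act T M (subE i₀ 0 x) m) = φ (act T M (wE i₂) m)) ∧
      (y ≤ x → ψ (act T M (subE i₀ y x) h) = 0) := by
  have hl := T.hℓ i₀
  have hx : ∃ x, ∃ m ∈ space T M .src, act T M (subE i₀ 0 (x + 1)) m = 0 ∧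
      act T M (wE i₂) m ≠ 0 := by
    obtain ⟨m, hm, hm'⟩ := hw
    refine ⟨T.ℓ i₀ - 1, m, hm, ?_, hm'⟩
    rw [Nat.sub_add_cancel hl]
    exact hr.act_zero_branch m
  obtain ⟨x, ⟨m₀, hm₀, hm₀x, hm₀w⟩, hxmin⟩ : ∃ x, (∃ m ∈ space T M .src,
      act T M (subE i₀ 0 (x + 1)) m = 0 ∧ act T M (wE i₂) m ≠ 0) ∧ x < T.ℓ i₀ ∧
      ∀ m ∈ space T M .src, act T M (subE i₀ 0 x) m = 0 → act T M (wE i₂) m = 0 := by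
    refine ⟨Nat.find hx, Nat.find_spec hx, ?_, fun m hm h => ?_⟩
    · obtain ⟨m, hm, hm'⟩ := hw
      refine (Nat.find_min' hx (m := T.ℓ i₀ - 1) ⟨m, hm, ?_, hm'⟩).trans_lt (by omega)
      rw [Nat.sub_add_cancel hl]
      exact hr.act_zero_branch m
    · rcases Nat.eq_zero_or_pos (Nat.find hx) with h0 | h0
      · rw [h0, subE_self, act_one] at h
        rw [h, map_zero]
      · by_contra hne
        exact Nat.find_min hx (m := Nat.find hx - 1) (by omega)
          ⟨m, hm, by rwa [Nat.sub_add_cancel h0], hne⟩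
  obtain ⟨hxl, hxmin⟩ := hxmin
  let Q : ℕ → Prop := fun y => ∃ v ∈ space T M .src, ∃ h ∈ space T M (vtx T.t T.ℓ i₀ y),
    act T M (subE i₀ 0 (x + 1)) v = 0 ∧ act T M (wE i₂) v ≠ 0 ∧
      act T M (subE i₀ y (T.ℓ i₀)) h = act T M (wE i₂) v
  have hQl : Q (T.ℓ i₀) := by
    refine ⟨m₀, hm₀, act T M (wE i₂) m₀, ?_, hm₀x, hm₀w, by simp⟩
    rw [vtx_last T.hℓ, ← vtx_last T.hℓ i₂]
    exact act_subE_mem i₂ (Nat.zero_le _) (by simpa using hm₀)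
  have hy : ∃ y, Q y := ⟨_, hQl⟩
  obtain ⟨v, hv, h, hh, hvx, hvw, hhv⟩ := Nat.find_spec hy
  have hyl : Nat.find hy ≤ T.ℓ i₀ := Nat.find_min' hy hQl
  have hymin : ∀ a, a < Nat.find hy → ¬ Q a := fun a => Nat.find_min hy
  generalize Nat.find hy = y at hh hhv hyl hymin
  have hy1 : 1 ≤ y := by
    by_contra h0
    obtain rfl : y = 0 := by omega
    exact hvw (hhv.symm.trans (hr.act_zero_branch h))
  obtain ⟨φ, hφ1, hφ⟩ := exists_functional_separating
    ((space T M (vtx T.t T.ℓ i₀ (y - 1))).map (act T M (subE i₀ (y - 1) (T.ℓ i₀))))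
    (u := act T M (wE i₂) v) (by
      rintro ⟨m, hm, hmv⟩
      exact hymin (y - 1) (by omega) ⟨v, hv, m, hm, hvx, hvw, hmv⟩)
  have hφ' : ∀ a < y, ∀ m ∈ space T M (vtx T.t T.ℓ i₀ a),
      φ (act T M (subE i₀ a (T.ℓ i₀)) m) = 0 := by
    intro a ha m hm
    rw [← act_subE_subE i₀ (b := y - 1) (by omega) (by omega)]
    exact hφ _ (Submodule.mem_map_of_mem (act_subE_mem i₀ (by omega) hm))
  let ε : k := if y ≤ x then 1 else 0
  obtain ⟨ψ, hψ⟩ := exists_functional_factor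
    (((act T M (subE i₀ 0 x)).comp (space T M .src).subtype).coprod
      (ε • LinearMap.toSpanSingleton k M (act T M (subE i₀ y x) h)))
    (((φ.comp (act T M (wE i₂))).comp (space T M .src).subtype).coprod 0) (by
      rintro ⟨⟨m, hm⟩, c⟩ hz
      simp only [LinearMap.coprod_apply, LinearMap.comp_apply, Submodule.subtype_apply,
        LinearMap.smul_apply, LinearMap.toSpanSingleton_apply, LinearMap.zero_apply,
        add_zero] at hz ⊢
      have hc : (ε • c • act T M (subE i₀ y x) h) = 0 := by
        by_cases hyx : y ≤ x
        · have := congrArg (act T M (subE i₀ x (T.ℓ i₀))) hz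
          rw [map_add, map_smul, map_smul, act_subE_subE i₀ (Nat.zero_le x) hxl.le,
            act_subE_subE i₀ hyx hxl.le, map_zero, hhv] at this
          change act T M (wE i₀) m + _ = 0 at this
          rw [hr.act_zero_branch, zero_add] at this
          have hc0 : c = 0 := by simpa [ε, hyx, hvw] using this
          simp [hc0]
        · simp [ε, hyx]
      rw [hc, add_zero] at hz
      rw [hxmin m hm hz, map_zero])
  refine ⟨x, y, v, h, φ, ψ, hxl, hy1, hyl, hv, hh, hvx, hhv, hφ1, hφ', fun m hm => ?_,
    fun hyx => ?_⟩
  · simpa using hψ (⟨m, hm⟩, 0)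
  · simpa [ε, hyx] using hψ (0, 1)

lemma exists_frame (hr : BranchRel T i₀ i₂)
    (hind : ∀ f : M →ₗ[(Alg T)ᵐᵒᵖ] M, f.comp f = f → f = 0 ∨ f = LinearMap.id)
    (hw : ∃ m ∈ space T M .src, act T M (wE i₂) m ≠ 0) :
    ∃ x y v h, Frame T M i₀ i₂ x y v h := by
  obtain ⟨x, y, v, h, φ, ψ, hxl, hy1, hyl, hv, hh, hvx, hhv, hφ1, hφ, hψ, hψh⟩ :=
    exists_splitting_data hr hw
  have hvw : act T M (wE i₂) v ≠ 0 := by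
    intro h0
    rw [h0, map_zero] at hφ1
    exact zero_ne_one hφ1
  choose! c hc0 hc using hr.smul
  let A : Fin T.t → ℕ → M →ₗ[k] k := fun i a =>
    if i = i₀ then (if a ≤ x then ψ.comp (act T M (subE i₀ a x)) else 0)
    else (c i)⁻¹ • φ.comp (act T M (subE i a (T.ℓ i)))
  let B : ℕ → M →ₗ[k] k := fun a =>
    if y ≤ a then φ.comp (act T M (subE i₀ a (T.ℓ i₀))) else 0
  let G : Fin T.t → ℕ → M →ₗ[k] M := fun i a =>
    (A i a).smulRight (act T M (subE i 0 a) v) +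
      if i = i₀ then (B a).smulRight (act T M (subE i₀ y a) h) else 0
  have hv' : ∀ i, v ∈ space T M (vtx T.t T.ℓ i 0) := fun i => by simpa using hv
  have hG₁ : ∀ i, i ≠ i₀ → ∀ a m,
      G i a m = ((c i)⁻¹ * φ (act T M (subE i a (T.ℓ i)) m)) • act T M (subE i 0 a) v := by
    intro i hi a m
    simp [G, A, hi]
  have hG₀ : ∀ a m, G i₀ a m = (if a ≤ x then ψ (act T M (subE i₀ a x) m) else 0) •
      act T M (subE i₀ 0 a) v +
      (if y ≤ a then φ (act T M (subE i₀ a (T.ℓ i₀)) m) else 0) • act T M (subE i₀ y a) h := by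
    intro a m
    by_cases h1 : a ≤ x <;> by_cases h2 : y ≤ a <;> simp [G, A, B, h1, h2]
  have hw' : ∀ i, i ≠ i₀ → ∀ m, act T M (subE i 0 (T.ℓ i)) m = c i • act T M (wE i₂) m :=
    fun i hi m => act_of_mkA_eq_smul (hc i hi) m
  have hsrc : ∀ i, ∀ m ∈ space T M .src, G i 0 m = φ (act T M (wE i₂) m) • v := by
    intro i m hm
    by_cases hi : i = i₀
    · subst hi
      rw [hG₀, if_pos (Nat.zero_le x), if_neg (by omega), hψ m hm]
      simp
    · rw [hG₁ i hi, hw' i hi, map_smul, smul_eq_mul, inv_mul_cancel_left₀ (hc0 i hi)]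
      simp
  have hsnk : ∀ i m, G i (T.ℓ i) m = φ m • act T M (wE i₂) v := by
    intro i m
    by_cases hi : i = i₀
    · subst hi
      rw [hG₀, if_neg (by omega), if_pos hyl, hhv]
      simp
    · rw [hG₁ i hi, hw' i hi, smul_smul, mul_right_comm, inv_mul_cancel₀ (hc0 i hi)]
      simp
  obtain ⟨f, hf⟩ := exists_endomorphism G
    (by
      intro i a ha m hm
      by_cases hi : i = i₀
      · subst hi
        rw [hG₀]
        refine add_mem (Submodule.smul_mem _ _ (act_subE_mem i (Nat.zero_le a) (hv' i))) ?_
        split_ifs with hya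
        · exact Submodule.smul_mem _ _ (act_subE_mem i hya hh)
        · simp
      · rw [hG₁ i hi]
        exact Submodule.smul_mem _ _ (act_subE_mem i (Nat.zero_le a) (hv' i)))
    (fun i j m hm => by rw [hsrc i m hm, hsrc j m hm])
    (fun i j m _ => by rw [hsnk, hsnk])
    (by
      intro i a ha m hm
      by_cases hi : i = i₀
      · subst hi
        rw [hG₀, hG₀, map_add, map_smul, map_smul, act_arE_subE i (Nat.zero_le a)]
        congr 1
        · rcases lt_trichotomy a x with hax | rfl | hax
          · rw [if_pos hax.le, if_pos (by omega), act_subE_arE i hax]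
          · rw [hvx, smul_zero, smul_zero]
          · rw [if_neg (by omega), if_neg (by omega), zero_smul]
        · rw [act_subE_arE i ha]
          by_cases hya : y ≤ a
          · rw [if_pos hya, if_pos (by omega), act_arE_subE i hya]
          · rw [if_neg hya, hφ a (by omega) m hm]
            simp
      · rw [hG₁ i hi, hG₁ i hi, map_smul, act_arE_subE i (Nat.zero_le a), act_subE_arE i ha])
  have hff : f.comp f = f := by
    refine LinearMap.ext fun m => ?_
    refine eq_of_forall_space T (f.comp f).toAddMonoidHom f.toAddMonoidHom ?_ m
    intro i a ha m hm
    change f (f m) = f m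
    have hfk : ∀ (r : k) (m : M), f (r • m) = r • f m := by
      intro r m
      rw [← algebraMap_smul (Alg T)ᵐᵒᵖ r m, map_smul, algebraMap_smul]
    have hsv : act T M (subE i 0 a) v ∈ space T M (vtx T.t T.ℓ i a) :=
      act_subE_mem i (Nat.zero_le a) (hv' i)
    rw [hf i a ha m hm]
    by_cases hi : i = i₀
    · subst hi
      have e1 : a ≤ x → f (act T M (subE i 0 a) v) = act T M (subE i 0 a) v := by
        intro hax
        rw [hf i a ha _ hsv, hG₀, if_pos hax, act_subE_subE i (Nat.zero_le a) hax, hψ v hv, hφ1,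
          act_subE_subE i (Nat.zero_le a) ha]
        have : act T M (subE i 0 (T.ℓ i)) v = 0 := hr.act_zero_branch v
        simp [this]
      have e2 : y ≤ a → f (act T M (subE i y a) h) = act T M (subE i y a) h := by
        intro hya
        rw [hf i a ha _ (act_subE_mem i hya hh), hG₀, if_pos hya, act_subE_subE i hya ha, hhv, hφ1,
          one_smul]
        by_cases hax : a ≤ x
        · rw [if_pos hax, act_subE_subE i hya hax, hψh (hya.trans hax), zero_smul, zero_add]
        · rw [if_neg hax, zero_smul, zero_add]
      rw [hG₀, map_add, hfk, hfk]
      congr 1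
      · by_cases hax : a ≤ x
        · rw [e1 hax]
        · simp [hax]
      · by_cases hya : y ≤ a
        · rw [e2 hya]
        · simp [hya]
    · rw [hG₁ i hi, hfk, hf i a ha _ hsv, hG₁ i hi, act_subE_subE i (Nat.zero_le a) ha, hw' i hi,
        map_smul, hφ1, smul_eq_mul, mul_one, inv_mul_cancel₀ (hc0 i hi), one_smul]
  have hfv : f v = v := by
    rw [hf i₀ 0 (Nat.zero_le _) v (hv' i₀), hsrc i₀ v hv, hφ1, one_smul]
  have hid : f = LinearMap.id := by
    refine (hind f hff).resolve_left fun h0 => hvw ?_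
    rw [h0, LinearMap.zero_apply] at hfv
    rw [← hfv, map_zero]
  refine ⟨x, y, v, h, hxl, hy1, hyl, hv, hh, hvx, ?_, hvw, hhv, fun i hi a ha m hm => ?_,
    fun a ha m hm => ?_⟩
  · intro h0
    have := hψ v hv
    rw [h0, map_zero, hφ1] at this
    exact zero_ne_one this
  · exact ⟨_, by rw [← hG₁ i hi a m, ← hf i a ha m hm, hid, LinearMap.id_apply]⟩
  · refine ⟨_, _, ?_, ?_, by rw [← hG₀ a m, ← hf i₀ a ha m hm, hid, LinearMap.id_apply]⟩
    · exact fun h => if_neg (by omega)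
    · exact fun h => if_neg (by omega)

lemma exists_branch_ne_zero (hr : BranchRel T i₀ i₂)
    (hind : ∀ f : M →ₗ[(Alg T)ᵐᵒᵖ] M, f.comp f = f → f = 0 ∨ f = LinearMap.id)
    (h0 : ∃ m ∈ space T M .src, m ≠ 0) (hinf : ∃ m ∈ space T M .snk, m ≠ 0) :
    ∃ m ∈ space T M .src, act T M (wE i₂) m ≠ 0 := by
  by_contra! hw
  obtain ⟨f, hff, hf0, hf1⟩ := exists_idempotent_of_branches_zero (T := T) (M := M) (by
    intro i m hm
    by_cases hi : i = i₀
    · rw [hi, hr.act_zero_branch]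
    · obtain ⟨c, _, hc⟩ := hr.smul i hi
      rw [act_of_mkA_eq_smul hc, hw m hm, smul_zero])
  obtain ⟨m, hm, hm'⟩ := h0
  obtain ⟨n, hn, hn'⟩ := hinf
  rcases hind f hff with rfl | rfl
  · exact hm' (hf0 m hm).symm
  · exact hn' (hf1 n hn)

end Splitting

section Frames

variable {i₀ i₂ : Fin T.t} {x y : ℕ} {v h : M}

lemma act_mem (N : Submodule (Alg T)ᵐᵒᵖ M) (p : PathAlg k T.t T.ℓ) {m : M} (hm : m ∈ N) :
    act T M p m ∈ N := N.smul_mem _ hm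

lemma BranchRel.act_branch_ne (hr : BranchRel T i₀ i₂) {i : Fin T.t} (hi : i ≠ i₀)
    (hv : act T M (wE i₂) v ≠ 0) : act T M (wE i) v ≠ 0 := by
  obtain ⟨c, hc0, hc⟩ := hr.smul i hi
  rw [act_of_mkA_eq_smul hc]
  exact smul_ne_zero hc0 hv

lemma Frame.eq_top (hF : Frame T M i₀ i₂ x y v h) (N : Submodule (Alg T)ᵐᵒᵖ M) (hv : v ∈ N)
    (hh : h ∈ N) : N = ⊤ := by
  rw [eq_top_iff]
  intro m _
  rw [← sum_act_eV T m]
  refine sum_mem fun w _ => ?_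
  obtain ⟨i, a, ha, rfl⟩ := exists_eq_vtx T.hℓ i₀ w
  have hm := act_eV_mem (vtx T.t T.ℓ i a) m
  by_cases hi : i = i₀
  · subst hi
    obtain ⟨c, c', -, -, hc⟩ := hF.special a ha _ hm
    rw [hc]
    exact add_mem (N.smul_of_tower_mem c (act_mem N _ hv)) (N.smul_of_tower_mem c' (act_mem N _ hh))
  · obtain ⟨c, hc⟩ := hF.other i hi a ha _ hm
    rw [hc]
    exact N.smul_of_tower_mem c (act_mem N _ hv)

lemma Frame.act_branch (hF : Frame T M i₀ i₂ x y v h) (hr : BranchRel T i₀ i₂) {a : ℕ}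
    (ha : a ≤ T.ℓ i₀) (c c' : k) (hay : a < y → c' = 0) :
    act T M (subE i₀ a (T.ℓ i₀)) (c • act T M (subE i₀ 0 a) v + c' • act T M (subE i₀ y a) h) =
      c' • act T M (wE i₂) v := by
  rw [map_add, map_smul, map_smul, act_subE_subE i₀ (Nat.zero_le a) ha]
  have : act T M (subE i₀ 0 (T.ℓ i₀)) v = 0 := hr.act_zero_branch v
  rw [this, smul_zero, zero_add]
  by_cases hya : y ≤ a
  · rw [act_subE_subE i₀ hya ha, hF.h_eq]
  · rw [hay (by omega), zero_smul, zero_smul]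

lemma Frame.act_ne_zero (hF : Frame T M i₀ i₂ x y v h) {a : ℕ} (ha : a ≤ x) :
    act T M (subE i₀ a x) (act T M (subE i₀ 0 a) v) ≠ 0 := by
  rw [act_subE_subE i₀ (Nat.zero_le a) ha]
  exact hF.v_ne

lemma Frame.exists_socle (hF : Frame T M i₀ i₂ x y v h) (hr : BranchRel T i₀ i₂)
    (N : Submodule (Alg T)ᵐᵒᵖ M) (hN : N ≠ ⊥) :
    ∃ w ∈ ({.snk, vtx T.t T.ℓ i₀ x} : Set (Vtx T.t T.ℓ)), ∃ m ∈ N, act T M (eV w) m ≠ 0 := by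
  obtain ⟨n, hn, hn0⟩ := N.exists_mem_ne_zero_of_ne_bot hN
  obtain ⟨w, hw⟩ : ∃ w : Vtx T.t T.ℓ, act T M (eV w) n ≠ 0 := by
    by_contra! hall
    exact hn0 (by rw [← sum_act_eV T n]; exact Finset.sum_eq_zero fun w _ => hall w)
  obtain ⟨i, a, ha, rfl⟩ := exists_eq_vtx T.hℓ i₀ w
  have hm := act_eV_mem (vtx T.t T.ℓ i a) n
  have hmN : act T M (eV (vtx T.t T.ℓ i a)) n ∈ N := act_mem N _ hn
  generalize act T M (eV (vtx T.t T.ℓ i a)) n = m at hw hm hmN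
  have hsnk : act T M (subE i a (T.ℓ i)) m ≠ 0 →
      ∃ w ∈ ({.snk, vtx T.t T.ℓ i₀ x} : Set (Vtx T.t T.ℓ)), ∃ m ∈ N, act T M (eV w) m ≠ 0 := by
    intro hne
    refine ⟨.snk, by simp, _, act_mem N (subE i a (T.ℓ i)) hmN, ?_⟩
    have := mem_space.1 (act_subE_mem i ha hm)
    rw [vtx_last T.hℓ] at this
    rwa [this]
  by_cases hi : i = i₀
  · subst hi
    obtain ⟨c, c', hc, hc', hmc⟩ := hF.special a ha m hm
    by_cases hc0 : c' = 0
    · rw [hc0, zero_smul, add_zero] at hmc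
      have hcne : c ≠ 0 := by
        rintro rfl
        exact hw (by rw [hmc, zero_smul])
      have hax : a ≤ x := by
        by_contra hax
        exact hcne (hc (by omega))
      refine ⟨vtx T.t T.ℓ i x, by simp, _, act_mem N (subE i a x) hmN, ?_⟩
      rw [mem_space.1 (act_subE_mem i hax hm), hmc, map_smul]
      exact smul_ne_zero hcne (hF.act_ne_zero hax)
    · apply hsnk
      rw [hmc, hF.act_branch hr ha c c' hc']
      exact smul_ne_zero hc0 hF.w_ne
  · obtain ⟨c, hc⟩ := hF.other i hi a ha m hm
    apply hsnk
    rw [hc, map_smul, act_subE_subE i (Nat.zero_le a) ha]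
    refine smul_ne_zero ?_ (hr.act_branch_ne hi hF.w_ne)
    rintro rfl
    exact hw (by rw [hc, zero_smul])

/-- Families of subspaces at the vertices stable under the arrows are submodules. -/
lemma exists_submodule_of_family (W : Vtx T.t T.ℓ → Submodule k M)
    (hW : ∀ i a, a < T.ℓ i → ∀ m ∈ W (vtx T.t T.ℓ i a),
      act T M (arE i a) m ∈ W (vtx T.t T.ℓ i (a + 1))) :
    ∃ S : Submodule (Alg T)ᵐᵒᵖ M, ∀ m, m ∈ S ↔ ∀ w, act T M (eV w) m ∈ W w := by
  have key : ∀ (p : PathAlg k T.t T.ℓ) (m : M), (∀ w, act T M (eV w) m ∈ W w) →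
      ∀ w, act T M (eV w) (act T M p m) ∈ W w := by
    intro p
    induction p using pathAlg_induction with
    | heV u =>
      intro m hm w
      by_cases h : u = w
      · subst h
        rw [mem_space.1 (act_eV_mem u m)]
        exact hm u
      · rw [act_eV_of_ne h (act_eV_mem u m)]
        exact zero_mem _
    | harE i j =>
      intro m hm w
      rcases lt_or_ge j (T.ℓ i) with hj | hj
      · by_cases h : vtx T.t T.ℓ i (j + 1) = w
        · subst h
          rw [mem_space.1 (act_arE_mem i j m), ← act_arE_eV]
          exact hW i j hj _ (hm _)
        · rw [act_eV_of_ne h (act_arE_mem i j m)]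
          exact zero_mem _
      · simp [arE_eq_zero hj]
    | halg c =>
      intro m hm w
      rw [act_algebraMap, map_smul]
      exact Submodule.smul_mem _ _ (hm w)
    | hadd p q hp hq =>
      intro m hm w
      rw [act_add, map_add]
      exact add_mem (hp m hm w) (hq m hm w)
    | hmul p q hp hq =>
      intro m hm
      simp only [act_mul]
      exact hq _ (hp m hm)
  refine ⟨
    { carrier := {m | ∀ w, act T M (eV w) m ∈ W w}
      add_mem' := ?_
      zero_mem' := ?_
      smul_mem' := ?_ }, fun m => Iff.rfl⟩
  · intro a b ha hb w
    rw [map_add]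
    exact add_mem (ha w) (hb w)
  · intro w
    rw [map_zero]
    exact zero_mem _
  · intro r m hm
    obtain ⟨p, hp⟩ := exists_act_eq_smul (M := M) r
    rw [hp]
    exact key p m hm

variable {D : Type*} [AddCommGroup D] [Module (Alg T)ᵐᵒᵖ D] [Module k D]
  [IsScalarTower k (Alg T)ᵐᵒᵖ D] {g e : D}

lemma map_act {N : Type*} [AddCommGroup N] [Module (Alg T)ᵐᵒᵖ N] [Module k N]
    [IsScalarTower k (Alg T)ᵐᵒᵖ N] (Φ : D →ₗ[(Alg T)ᵐᵒᵖ] N) (p : PathAlg k T.t T.ℓ) (d : D) :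
    Φ (act T D p d) = act T N p (Φ d) := map_smul Φ _ d

/-- The spaces of a module generated by two elements satisfying the relations of `D x y` are spanned
by the translates of the generators. -/
lemma exists_translates (hr : BranchRel T i₀ i₂) (hy : 1 ≤ y) (hyl : y ≤ T.ℓ i₀)
    (hg : g ∈ space T D .src) (he : e ∈ space T D (vtx T.t T.ℓ i₀ y))
    (hge : act T D (wE i₂) g = act T D (subE i₀ y (T.ℓ i₀)) e)
    (hgen : ∀ S : Submodule (Alg T)ᵐᵒᵖ D, g ∈ S → e ∈ S → S = ⊤) :
    (∀ i, i ≠ i₀ → ∀ a ≤ T.ℓ i, ∀ m ∈ space T D (vtx T.t T.ℓ i a),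
      ∃ c : k, m = c • act T D (subE i 0 a) g) ∧
    (∀ a ≤ T.ℓ i₀, ∀ m ∈ space T D (vtx T.t T.ℓ i₀ a), ∃ c c' : k, (a < y → c' = 0) ∧
      m = c • act T D (subE i₀ 0 a) g + c' • act T D (subE i₀ y a) e) := by
  let G : Fin T.t → ℕ → Submodule k D := fun i a =>
    k ∙ act T D (subE i 0 a) g ⊔ if i = i₀ ∧ y ≤ a then k ∙ act T D (subE i₀ y a) e else ⊥
  obtain ⟨W, hW⟩ := exists_vertex_family T.hℓ G (k ∙ g) (k ∙ act T D (wE i₂) g)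
    (fun i => by simp [G, show y ≠ 0 by omega])
    (fun i => by
      by_cases hi : i = i₀
      · subst hi
        have : act T D (subE i 0 (T.ℓ i)) g = 0 := hr.act_zero_branch g
        simp [G, hyl, hge, this]
      · obtain ⟨c, hc0, hc⟩ := hr.smul i hi
        have : act T D (subE i 0 (T.ℓ i)) g = c • act T D (wE i₂) g := act_of_mkA_eq_smul hc g
        simp [G, hi, this, Submodule.span_singleton_smul_eq (IsUnit.mk0 c hc0)])
  obtain ⟨S, hS⟩ := exists_submodule_of_family W (by
    intro i a ha m hm
    rw [hW i a ha.le] at hm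
    rw [hW i (a + 1) ha]
    obtain ⟨n, hn, n', hn', rfl⟩ := Submodule.mem_sup.1 hm
    obtain ⟨c, rfl⟩ := Submodule.mem_span_singleton.1 hn
    rw [map_add, map_smul, act_arE_subE i (Nat.zero_le a)]
    refine add_mem (Submodule.mem_sup_left (Submodule.smul_mem _ _
      (Submodule.mem_span_singleton_self _))) (Submodule.mem_sup_right ?_)
    split_ifs at hn' with h1
    · obtain ⟨rfl, h1⟩ := h1
      obtain ⟨c, rfl⟩ := Submodule.mem_span_singleton.1 hn'
      rw [if_pos ⟨rfl, by omega⟩, map_smul, act_arE_subE i h1]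
      exact Submodule.smul_mem _ _ (Submodule.mem_span_singleton_self _)
    · rw [(Submodule.mem_bot k).1 hn', map_zero]
      exact zero_mem _)
  have hmem : ∀ w, ∀ d ∈ space T D w, d ∈ W w → d ∈ S := by
    intro w d hd hdW
    rw [hS]
    intro u
    by_cases hu : w = u
    · subst hu
      rwa [mem_space.1 hd]
    · rw [act_eV_of_ne hu hd]
      exact zero_mem _
  have htop := hgen S (hmem _ g hg (by
      rw [← vtx_zero i₀, hW i₀ 0 (Nat.zero_le _)]
      exact Submodule.mem_sup_left (by simp [Submodule.mem_span_singleton_self])))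
    (hmem _ e he (by
      rw [hW i₀ y hyl]
      exact Submodule.mem_sup_right (by simp [Submodule.mem_span_singleton_self])))
  have hall : ∀ i, ∀ a ≤ T.ℓ i, ∀ m ∈ space T D (vtx T.t T.ℓ i a), m ∈ G i a := by
    intro i a ha m hm
    have : m ∈ S := htop ▸ Submodule.mem_top
    rw [hS] at this
    rw [← hW i a ha, ← mem_space.1 hm]
    exact this _
  refine ⟨fun i hi a ha m hm => ?_, fun a ha m hm => ?_⟩
  · have := hall i a ha m hm
    simp only [G, hi, false_and, if_false, sup_bot_eq] at this
    obtain ⟨c, hc⟩ := Submodule.mem_span_singleton.1 this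
    exact ⟨c, hc.symm⟩
  · obtain ⟨n, hn, n', hn', rfl⟩ := Submodule.mem_sup.1 (hall i₀ a ha m hm)
    obtain ⟨c, rfl⟩ := Submodule.mem_span_singleton.1 hn
    split_ifs at hn' with h1
    · obtain ⟨c', rfl⟩ := Submodule.mem_span_singleton.1 hn'
      exact ⟨c, c', fun h => by omega, rfl⟩
    · exact ⟨c, 0, fun _ => rfl, by rw [(Submodule.mem_bot k).1 hn', zero_smul]⟩

lemma Frame.bijective (hF : Frame T M i₀ i₂ x y v h) (hr : BranchRel T i₀ i₂)
    (Φ : D →ₗ[(Alg T)ᵐᵒᵖ] M) (hΦg : Φ g = v) (hΦe : Φ e = h)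
    (hg : g ∈ space T D .src) (he : e ∈ space T D (vtx T.t T.ℓ i₀ y))
    (hgx : act T D (subE i₀ 0 (x + 1)) g = 0)
    (hge : act T D (wE i₂) g = act T D (subE i₀ y (T.ℓ i₀)) e)
    (hgen : ∀ S : Submodule (Alg T)ᵐᵒᵖ D, g ∈ S → e ∈ S → S = ⊤) : Function.Bijective Φ := by
  constructor
  · rw [injective_iff_map_eq_zero]
    intro d hd
    obtain ⟨h1, h2⟩ := exists_translates hr hF.y_pos hF.y_le hg he hge hgen
    rw [← sum_act_eV T d]
    refine Finset.sum_eq_zero fun w _ => ?_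
    obtain ⟨i, a, ha, rfl⟩ := exists_eq_vtx T.hℓ i₀ w
    have hm := act_eV_mem (vtx T.t T.ℓ i a) d
    have hΦm : Φ (act T D (eV (vtx T.t T.ℓ i a)) d) = 0 := by rw [map_act, hd, map_zero]
    generalize act T D (eV (vtx T.t T.ℓ i a)) d = m at hm hΦm
    have hΦk : ∀ (c : k) (n : D), Φ (c • n) = c • Φ n := fun c n => by
      rw [← algebraMap_smul (Alg T)ᵐᵒᵖ c n, map_smul, algebraMap_smul]
    by_cases hi : i = i₀
    · subst hi
      obtain ⟨c, c', hc', rfl⟩ := h2 a ha m hm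
      rw [map_add, hΦk, hΦk, map_act, map_act, hΦg, hΦe] at hΦm
      have hc0 : c' = 0 := by
        have := hF.act_branch hr ha c c' hc'
        rw [hΦm, map_zero] at this
        exact (smul_eq_zero.1 this.symm).resolve_right hF.w_ne
      rw [hc0, zero_smul, add_zero] at hΦm ⊢
      rcases le_or_gt a x with hax | hax
      · have := hF.act_ne_zero hax
        rw [(smul_eq_zero.1 hΦm).resolve_right fun h => this (by rw [h, map_zero]), zero_smul]
      · rw [← act_subE_subE i (Nat.zero_le (x + 1)) hax, hgx, map_zero, smul_zero]
    · obtain ⟨c, rfl⟩ := h1 i hi a ha m hm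
      rw [hΦk, map_act, hΦg] at hΦm
      rw [(smul_eq_zero.1 hΦm).resolve_right fun h => hr.act_branch_ne hi hF.w_ne ?_, zero_smul]
      rw [wE, ← act_subE_subE i (Nat.zero_le a) ha, h, map_zero]
  · rw [← LinearMap.range_eq_top]
    exact hF.eq_top _ ⟨g, hΦg⟩ ⟨e, hΦe⟩

end Frames

end Modules

/-- The homomorphism from the right regular module sending `1` to `m`. -/
def fromRegular {k : Type u} [Field k] (T : ToupieAlg k) {M : Type*} [AddCommGroup M]
    [Module (Alg T)ᵐᵒᵖ M] (m : M) : Alg T →ₗ[(Alg T)ᵐᵒᵖ] M where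
  toFun a := op a • m
  map_add' a b := by rw [op_add, add_smul]
  map_smul' r a := by
    rw [RingHom.id_apply, smul_smul]
    rfl

lemma mkA_one_sub {k : Type*} [Field k] {T : ToupieAlg k} (p : PathAlg k T.t T.ℓ) :
    mkA T (1 - p) = 1 - mkA T p :=
  (map_sub (mkA T) 1 p).trans (by rw [map_one])

lemma Frame.nonempty_equiv {k : Type u} [Field k] {T : ToupieAlg k} {M : Type u}
    [AddCommGroup M] [Module (Alg T)ᵐᵒᵖ M] [Module k M] [IsScalarTower k (Alg T)ᵐᵒᵖ M]
    {i₀ i₂ : Fin T.t} {x y : ℕ} {v h : M} (hF : Frame T M i₀ i₂ x y v h)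
    (hr : BranchRel T i₀ i₂) : Nonempty (M ≃ₗ[(Alg T)ᵐᵒᵖ] Dmod T i₀ i₂ x y) := by
  have hmin : min (x + 1) (T.ℓ i₀) = x + 1 := min_eq_left hF.x_lt
  let π := Submodule.mkQ (Submodule.span (Alg T)ᵐᵒᵖ
    ({((mkA T (1 - eV Vtx.src) : Alg T), (0 : Alg T)),
      ((0 : Alg T), (mkA T (1 - eV (vtx T.t T.ℓ i₀ y)) : Alg T)),
      ((mkA T (subE i₀ 0 (min (x + 1) (T.ℓ i₀))) : Alg T), (0 : Alg T)),
      ((mkA T (wE i₂) : Alg T), (- mkA T (subE i₀ y (T.ℓ i₀)) : Alg T))} :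
        Set (Alg T × Alg T)))
  let Φ : Dmod T i₀ i₂ x y →ₗ[(Alg T)ᵐᵒᵖ] M := Submodule.liftQ _
    ((fromRegular T v).coprod (fromRegular T h)) (by
      rw [Submodule.span_le]
      have hv := hF.v_mem
      have hh := hF.h_mem
      have hvx := hF.v_succ
      have hw := hF.h_eq
      simp only [mem_space, act_apply] at hv hh hvx hw
      rintro z (rfl | rfl | rfl | rfl)
      · simp [fromRegular, mkA_one_sub, sub_smul, hv]
      · simp [fromRegular, mkA_one_sub, sub_smul, hh]
      · simp [fromRegular, hmin, hvx]
      · simp [fromRegular, hw])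
  have hact : ∀ (p : PathAlg k T.t T.ℓ) (z : Alg T × Alg T),
      act T (Dmod T i₀ i₂ x y) p (π z) = π (z.1 * mkA T p, z.2 * mkA T p) := fun p z => rfl
  have hrel : ∀ z ∈ ({((mkA T (1 - eV Vtx.src) : Alg T), (0 : Alg T)),
      ((0 : Alg T), (mkA T (1 - eV (vtx T.t T.ℓ i₀ y)) : Alg T)),
      ((mkA T (subE i₀ 0 (min (x + 1) (T.ℓ i₀))) : Alg T), (0 : Alg T)),
      ((mkA T (wE i₂) : Alg T), (- mkA T (subE i₀ y (T.ℓ i₀)) : Alg T))} :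
        Set (Alg T × Alg T)), π z = 0 := fun z hz =>
    (Submodule.Quotient.mk_eq_zero _).2 (Submodule.subset_span hz)
  have hbij := hF.bijective hr Φ (g := π (1, 0)) (e := π (0, 1))
    (by simp [Φ, π, fromRegular]) (by simp [Φ, π, fromRegular])
    (by
      rw [mem_space, hact, eq_comm, ← sub_eq_zero, ← map_sub]
      exact hrel _ (Or.inl (by simp [mkA_one_sub])))
    (by
      rw [mem_space, hact, eq_comm, ← sub_eq_zero, ← map_sub]
      exact hrel _ (Or.inr (Or.inl (by simp [mkA_one_sub]))))
    (by
      rw [hact]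
      exact hrel _ (Or.inr (Or.inr (Or.inl (by simp [hmin])))))
    (by
      rw [hact, hact, ← sub_eq_zero, ← map_sub]
      exact hrel _ (Or.inr (Or.inr (Or.inr (by simp)))))
    (by
      intro S hg he
      rw [eq_top_iff]
      intro d _
      obtain ⟨⟨a, b⟩, rfl⟩ := Submodule.mkQ_surjective _ d
      have : (a, b) = op a • ((1, 0) : Alg T × Alg T) + op b • ((0, 1) : Alg T × Alg T) := by
        simp
      rw [this, map_add, map_smul, map_smul]
      exact add_mem (S.smul_mem _ hg) (S.smul_mem _ he))
  exact ⟨(LinearEquiv.ofBijective Φ hbij).symm⟩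

/-- Let `A = kQ/I` be a non simply connected toupie algebra with
`dim_k e₀ A e∞ = 1` whose unique branch lying in `I` is `w i₀`, and let `M` be an
indecomposable (finite-dimensional right) `A`-module with `M_0 ≠ 0` and `M_∞ ≠ 0`.
Then there are vertices `x, y` on the branch `w i₀` (positions `0 ≤ x, y ≤ ℓ i₀`)
such that every simple summand of the top of `M` is a copy of `S_0` or of `S_y`, every
simple summand of the socle of `M` is a copy of `S_∞` or of `S_x`, and in fact `M` is
isomorphic to the module `D x y` determined by `x` and `y`. -/
theorem iso_D_of_nonvanishing {k : Type u} [Field k] (T : ToupieAlg k)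
    (hnsc : ¬ SimplyConnected T) (hm : mDim T = 1) (i₀ : Fin T.t)
    (hb : branchInI T i₀) (huniq : ∀ j : Fin T.t, branchInI T j → j = i₀)
    (M : ModuleCat.{u} (Alg T)ᵐᵒᵖ) (hind : Indec (Alg T)ᵐᵒᵖ M) (hfd : FdMod (Alg T)ᵐᵒᵖ M)
    (h0 : ¬ VanishAt T M Vtx.src) (hinf : ¬ VanishAt T M Vtx.snk) :
    ∃ x y : ℕ, x ≤ T.ℓ i₀ ∧ y ≤ T.ℓ i₀ ∧
      TopIn T M {Vtx.src, vtx T.t T.ℓ i₀ y} ∧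
      SocIn T M {Vtx.snk, vtx T.t T.ℓ i₀ x} ∧
      ∃ i₂ : Fin T.t, i₂ ≠ i₀ ∧
        Nonempty ((M : Type u) ≃ₗ[(Alg T)ᵐᵒᵖ] Dmod T i₀ i₂ x y) := by
  let : Module k M := Module.compHom _ (algebraMap k (Alg T)ᵐᵒᵖ)
  have : IsScalarTower k (Alg T)ᵐᵒᵖ M := IsScalarTower.of_algebraMap_smul fun _ _ => rfl
  obtain ⟨i₂, hr⟩ := exists_branchRel hm i₀ hb huniq
  have hex : ∀ w, ¬ VanishAt T M w → ∃ m ∈ space T M w, m ≠ 0 := by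
    intro w hw
    unfold VanishAt at hw
    push Not at hw
    obtain ⟨m, hm⟩ := hw
    exact ⟨_, act_eV_mem w m, hm⟩
  obtain ⟨x, y, v, h, hF⟩ := exists_frame hr hind.2
    (exists_branch_ne_zero hr hind.2 (hex _ h0) (hex _ hinf))
  refine ⟨x, y, hF.x_lt.le, hF.y_le, ?_, ?_, i₂, hr.ne, hF.nonempty_equiv hr⟩
  · intro N hN
    by_contra! hall
    have hv := hall .src (by simp) v
    have hh := hall (vtx T.t T.ℓ i₀ y) (by simp) h
    rw [show actV T .src • v = v from hF.v_mem] at hv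
    rw [show actV T (vtx T.t T.ℓ i₀ y) • h = h from hF.h_mem] at hh
    exact hN.1 (hF.eq_top N hv hh)
  · intro N hN
    exact hF.exists_socle hr N hN.1

end Toupie
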